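/- For all integers n ≥ 1 and 1 ≤ k ≤ n, let t(n,k) denote the number of partitions of [n] whose canonical sequence π avoids the pattern 1123 and satisfies πₙ = k. Then n · t(n,k) = k · C(2n−k−1, n−1), where C denotes the binomial coefficient; equivalently t(n,k) = (k/n)·C(2n−k−1,n−1). -/

import Mathlib

/-- `π` is the canonical sequence of a set partition: every entry is at least 1,
and each entry is at most one more than the maximum of the preceding entries
(so the first entry is 1). -/
def IsCanonicalSeq (π : List ℕ) : Prop :=
  ∀ i (h : i < π.length), 1 ≤ π.get ⟨i, h⟩ ∧ π.get ⟨i, h⟩ ≤ (π.take i).foldr max 0 + 1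

/-- `π` contains the pattern `σ`: there is a subsequence of `π`
order-isomorphic to `σ`. -/
def ContainsPat (π σ : List ℕ) : Prop :=
  ∃ f : Fin σ.length → Fin π.length, StrictMono f ∧
    ∀ i j : Fin σ.length, σ.get i < σ.get j ↔ π.get (f i) < π.get (f j)

/-- `π` avoids the pattern `σ`. -/
def AvoidsPat (π σ : List ℕ) : Prop := ¬ ContainsPat π σ

/-- `pAvoid n σ` is the number of canonical sequences of partitions of `[n]`
avoiding the pattern `σ`. -/
noncomputable def pAvoid (n : ℕ) (σ : List ℕ) : ℕ :=
  Set.ncard {π : List ℕ | π.length = n ∧ IsCanonicalSeq π ∧ AvoidsPat π σ}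

/-- Two patterns are equivalent if they have the same number of avoiders of
each size. -/
def PatEquiv (σ σ' : List ℕ) : Prop := ∀ n, pAvoid n σ = pAvoid n σ'

/-- The increasing sequence `1, 2, …, k`. -/
def iota (k : ℕ) : List ℕ := (List.range k).map (· + 1)

/-- The ballot numbers, indexed so that `ballot d k` is `k / (k + d) * C(k + 2d - 1, d)`. -/
def ballot : ℕ → ℕ → ℕ
  | 0, _ => 1
  | _ + 1, 0 => 0
  | d + 1, k + 1 => ballot d (k + 2) + ballot (d + 1) k

theorem ballot_add_choose (d k : ℕ) :
    ballot (d + 1) k + (k + 2 * d + 1).choose d = (k + 2 * d + 1).choose (d + 1) := by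
  induction d generalizing k with
  | zero =>
    induction k with
    | zero => simp [ballot]
    | succ k ih => simp [ballot] at *; omega
  | succ d ihd =>
    induction k with
    | zero =>
      rw [ballot, zero_add]
      exact Nat.choose_symm_of_eq_add (by omega)
    | succ k ih =>
      have h1 := ihd (k + 2)
      rw [ballot]
      have e : k + 1 + 2 * (d + 1) + 1 = (k + 2 * (d + 1) + 1) + 1 := by ring
      have e' : k + 2 + 2 * d + 1 = k + 2 * (d + 1) + 1 := by ring
      rw [e'] at h1
      rw [e, Nat.choose_succ_succ' _ (d + 1), Nat.choose_succ_succ' _ d]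
      omega

theorem add_mul_ballot (d k : ℕ) :
    (k + d) * ballot d k = k * (k + 2 * d - 1).choose d := by
  cases d with
  | zero => simp [ballot]
  | succ d =>
    have h := ballot_add_choose d k
    have e : k + 2 * (d + 1) - 1 = k + 2 * d + 1 := by omega
    have h2 := Nat.choose_succ_right_eq (k + 2 * d + 1) d
    have e2 : k + 2 * d + 1 - d = k + d + 1 := by omega
    rw [e2] at h2
    rw [e]
    nlinarith

theorem ballot_succ_eq_sum (d j : ℕ) :
    ballot (d + 1) j = ∑ i ∈ Finset.range j, ballot d (i + 2) := by
  induction j with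
  | zero => simp [ballot]
  | succ j ih => rw [ballot, Finset.sum_range_succ, ih, add_comm]

theorem sum_ballot_diagonal (d j : ℕ) :
    ∑ i ∈ Finset.range (d + 1), ballot (d - i) (j + i) = ballot d (j + 1) := by
  induction d generalizing j with
  | zero => simp [ballot]
  | succ d ih =>
    rw [Finset.sum_range_succ', ballot, ← ih (j + 1)]
    simp only [Nat.add_sub_add_right, add_zero, Nat.sub_zero]
    congr 1
    refine Finset.sum_congr rfl fun i _ => ?_
    congr 1
    ring

/-- The effect of appending the letter `k` on the state `(c, s)` of a sequence, where `c` is the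
largest letter that may be appended and `s` is the smallest repeated letter (or `c`, if all
letters are distinct). -/
def stateStep (k : ℕ) (p : ℕ × ℕ) : ℕ × ℕ :=
  if p.2 = p.1 ∧ k = p.1 then (p.1 + 1, p.1 + 1)
  else if k ≤ p.2 then (p.1, k) else (k, p.2)

/-- The state of a sequence whose letters are listed from last to first. -/
def seqState : List ℕ → ℕ × ℕ
  | [] => (1, 1)
  | k :: l => stateStep k (seqState l)

/-- The sequences of length `n`, listed from last to first, in which every letter is allowed by the
state of the preceding ones. -/
def allowedSeqs : ℕ → Finset (List ℕ)
  | 0 => {[]}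
  | n + 1 => (allowedSeqs n).biUnion fun l => (Finset.Icc 1 (seqState l).1).image (· :: l)

theorem nil_mem_allowedSeqs (n : ℕ) : [] ∈ allowedSeqs n ↔ n = 0 := by
  cases n <;> simp [allowedSeqs]

theorem cons_mem_allowedSeqs (n k : ℕ) (l : List ℕ) :
    k :: l ∈ allowedSeqs (n + 1) ↔ l ∈ allowedSeqs n ∧ 1 ≤ k ∧ k ≤ (seqState l).1 := by
  simp only [allowedSeqs, Finset.mem_biUnion, Finset.mem_image, Finset.mem_Icc]
  constructor
  · rintro ⟨l', h, k', h', e⟩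
    obtain ⟨rfl, rfl⟩ := List.cons.inj e
    exact ⟨h, h'⟩
  · rintro ⟨h, h'⟩
    exact ⟨l, h, k, h', rfl⟩

theorem sum_allowedSeqs_succ (n : ℕ) (F : ℕ × ℕ → ℕ) :
    ∑ l ∈ allowedSeqs (n + 1), F (seqState l) =
      ∑ l ∈ allowedSeqs n, ∑ k ∈ Finset.Icc 1 (seqState l).1, F (stateStep k (seqState l)) := by
  rw [allowedSeqs, Finset.sum_biUnion]
  · refine Finset.sum_congr rfl fun l _ => ?_
    rw [Finset.sum_image (by intro a _ b _ h; simpa using h)]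
    rfl
  · intro l _ l' _ hne
    simp only [Function.onFun, Finset.disjoint_left, Finset.mem_image]
    rintro _ ⟨k, -, rfl⟩ ⟨k', -, h⟩
    exact hne (List.cons.inj h).2.symm

theorem seqState_bounds {n : ℕ} {l : List ℕ} (h : l ∈ allowedSeqs n) :
    1 ≤ (seqState l).2 ∧ (seqState l).2 ≤ (seqState l).1 ∧ (seqState l).1 ≤ n + 1 := by
  induction l generalizing n with
  | nil => simp [seqState]
  | cons k l ih =>
    cases n with
    | zero => simp [allowedSeqs] at h
    | succ n =>
      rw [cons_mem_allowedSeqs] at h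
      have := ih h.1
      simp only [seqState, stateStep]
      grind

/-- The number of allowed sequences of length `n` in state `(c, s)`. -/
def stateCount (n c s : ℕ) : ℕ :=
  ∑ l ∈ allowedSeqs n, if seqState l = (c, s) then 1 else 0

theorem stateCount_eq_zero {n c s : ℕ} (h : n + 1 < c) : stateCount n c s = 0 := by
  refine Finset.sum_eq_zero fun l hl => if_neg fun e => ?_
  have := seqState_bounds hl
  rw [e] at this
  simp only at this
  omega

theorem stateCount_self_succ (n c : ℕ) :
    stateCount (n + 1) (c + 1) (c + 1) = stateCount n c c := by
  unfold stateCount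
  rw [sum_allowedSeqs_succ n (fun p => if p = (c + 1, c + 1) then 1 else 0)]
  refine Finset.sum_congr rfl fun l hl => ?_
  have hb := seqState_bounds hl
  generalize seqState l = p at hb
  obtain ⟨u, v⟩ := p
  simp only at hb ⊢
  have h : ∀ k ∈ Finset.Icc 1 u, (if stateStep k (u, v) = (c + 1, c + 1) then 1 else 0) =
      if k = c then (if (u, v) = (c, c) then 1 else 0) else 0 := by
    intro k hk
    rw [Finset.mem_Icc] at hk
    simp only [stateStep]
    grind
  rw [Finset.sum_congr rfl h, Finset.sum_ite_eq']
  grind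

theorem stateCount_self (n c : ℕ) :
    stateCount n c c = if c = n + 1 then 1 else 0 := by
  induction n generalizing c with
  | zero =>
    simp [stateCount, allowedSeqs, Finset.sum_singleton, seqState, eq_comm, -Finset.sum_boole]
  | succ n ih =>
    cases c with
    | zero =>
      refine (Finset.sum_eq_zero fun l hl => if_neg fun e => ?_).trans (by simp)
      have := seqState_bounds hl
      rw [e] at this
      simp at this
    | succ c => rw [stateCount_self_succ, ih]; simp

theorem stateCount_succ {n c s : ℕ} (hs : 1 ≤ s) (hsc : s < c) :
    stateCount (n + 1) c s =
      ∑ k ∈ Finset.Icc s c, stateCount n c k + ∑ k ∈ Finset.Icc c (n + 1), stateCount n k s := by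
  unfold stateCount
  rw [sum_allowedSeqs_succ n (fun p => if p = (c, s) then 1 else 0), Finset.sum_comm,
    Finset.sum_comm (s := Finset.Icc c (n + 1)), ← Finset.sum_add_distrib]
  refine Finset.sum_congr rfl fun l hl => ?_
  have hb := seqState_bounds hl
  generalize seqState l = p at hb
  obtain ⟨u, v⟩ := p
  simp only at hb ⊢
  have h : ∀ k ∈ Finset.Icc 1 u, (if stateStep k (u, v) = (c, s) then 1 else 0) =
      (if k = s then (if u = c ∧ s ≤ v then 1 else 0) else 0) +
        (if k = c then (if v = s ∧ c ≤ u then 1 else 0) else 0) := by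
    intro k hk
    rw [Finset.mem_Icc] at hk
    simp only [stateStep]
    grind
  have h1 : ∀ k ∈ Finset.Icc s c, (if (u, v) = (c, k) then 1 else 0) =
      if k = v then (if u = c then 1 else 0) else 0 := by
    intro k _
    grind
  have h2 : ∀ k ∈ Finset.Icc c (n + 1), (if (u, v) = (k, s) then 1 else 0) =
      if k = u then (if v = s then 1 else 0) else 0 := by
    intro k _
    grind
  rw [Finset.sum_congr rfl h, Finset.sum_congr rfl h1, Finset.sum_congr rfl h2,
    Finset.sum_add_distrib]
  simp only [Finset.sum_ite_eq', Finset.mem_Icc]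
  grind

theorem sum_ballot_column (d s j : ℕ) :
    ∑ k ∈ Finset.Ico s (s + j), ballot d (s + j + 1 - k) = ballot (d + 1) j := by
  rw [ballot_succ_eq_sum, ← Finset.sum_range_reflect, Finset.sum_Ico_eq_sum_range]
  refine Finset.sum_congr (by simp) fun i hi => ?_
  rw [Finset.mem_range] at hi
  congr 1
  omega

theorem stateCount_eq_ballot {n c s : ℕ} (hs : 1 ≤ s) (hsc : s < c) :
    stateCount n c s = if c ≤ n then ballot (n - c) (c + 1 - s) else 0 := by
  induction n generalizing c s with
  | zero =>
    rw [if_neg (by omega)]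
    simp only [stateCount, allowedSeqs, Finset.sum_singleton, seqState, Prod.mk.injEq]
    exact if_neg (by omega)
  | succ n ih =>
    rw [stateCount_succ hs hsc, ← Finset.Ico_add_one_right_eq_Icc, ← Finset.Ico_add_one_right_eq_Icc,
      Finset.sum_Ico_succ_top hsc.le, stateCount_self]
    have h1 : ∀ k ∈ Finset.Ico s c, stateCount n c k =
        if c ≤ n then ballot (n - c) (c + 1 - k) else 0 := by
      intro k hk
      rw [Finset.mem_Ico] at hk
      exact ih (by omega) hk.2
    have h2 : ∀ k ∈ Finset.Ico c (n + 1 + 1), stateCount n k s =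
        if k ≤ n then ballot (n - k) (k + 1 - s) else 0 := by
      intro k hk
      rw [Finset.mem_Ico] at hk
      exact ih hs (by omega)
    rw [Finset.sum_congr rfl h1, Finset.sum_congr rfl h2]
    rcases lt_trichotomy c (n + 1) with hc | hc | hc
    · obtain ⟨j, rfl⟩ := Nat.exists_eq_add_of_le hsc.le
      obtain ⟨d, rfl⟩ := Nat.exists_eq_add_of_le (Nat.lt_succ_iff.mp hc)
      rw [if_neg (by omega), if_pos (by omega), Finset.sum_Ico_succ_top (by omega),
        if_neg (by omega), show s + j + d + 1 - (s + j) = d + 1 by omega,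
        show s + j + 1 - s = j + 1 by omega, ballot, ← sum_ballot_diagonal d (j + 1),
        ← sum_ballot_column d s j, add_comm (∑ i ∈ Finset.range (d + 1), _), add_zero, add_zero]
      congr 1
      · refine Finset.sum_congr rfl fun k _ => ?_
        rw [if_pos (by omega), Nat.add_sub_cancel_left]
      · rw [Finset.sum_Ico_eq_sum_range]
        refine Finset.sum_congr (by congr 1; omega) fun i hi => ?_
        rw [Finset.mem_range] at hi
        rw [if_pos (by omega)]
        congr 1 <;> omega
    · subst hc
      simp [ballot]
    · rw [if_neg (by omega), if_neg (by omega), Finset.Ico_eq_empty (a := c) (by omega)]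
      simp [show ¬ c ≤ n by omega]

theorem sum_stateCount {n c : ℕ} (hc : 1 ≤ c) (hcn : c ≤ n + 1) :
    ∑ s ∈ Finset.Icc 1 c, stateCount n c s = ballot (n + 1 - c) (c - 1) := by
  rw [← Finset.Ico_add_one_right_eq_Icc, Finset.sum_Ico_succ_top hc, stateCount_self]
  have h : ∀ s ∈ Finset.Ico 1 c, stateCount n c s =
      if c ≤ n then ballot (n - c) (c + 1 - s) else 0 := by
    intro s hs
    rw [Finset.mem_Ico] at hs
    exact stateCount_eq_ballot hs.1 hs.2
  rw [Finset.sum_congr rfl h]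
  rcases hcn.lt_or_eq with h | rfl
  · obtain ⟨d, rfl⟩ := Nat.exists_eq_add_of_le (Nat.lt_succ_iff.mp h)
    obtain ⟨j, rfl⟩ := Nat.exists_eq_add_of_le hc
    have := sum_ballot_column d 1 j
    simp only [le_add_iff_nonneg_right, zero_le, if_true]
    rw [Nat.add_sub_cancel_left (1 + j) d, this, if_neg (by omega), add_zero]
    congr 1 <;> omega
  · simp [ballot]

theorem card_filter_allowedSeqs {n k : ℕ} (hk : 1 ≤ k) (hkn : k ≤ n + 1) :
    ((allowedSeqs n).filter fun l => k ≤ (seqState l).1).card = ballot (n + 1 - k) k := by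
  have h : ((allowedSeqs n).filter fun l => k ≤ (seqState l).1).card =
      ∑ c ∈ Finset.Icc k (n + 1), ∑ s ∈ Finset.Icc 1 c, stateCount n c s := by
    unfold stateCount
    rw [Finset.card_filter, Finset.sum_congr rfl fun c _ => Finset.sum_comm, Finset.sum_comm]
    refine Finset.sum_congr rfl fun l hl => ?_
    have hb := seqState_bounds hl
    generalize seqState l = p at hb
    obtain ⟨u, v⟩ := p
    simp only at hb ⊢
    have h1 : ∀ c ∈ Finset.Icc k (n + 1), ∑ s ∈ Finset.Icc 1 c, (if (u, v) = (c, s) then 1 else 0) =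
        if c = u then 1 else 0 := by
      intro c _
      rw [Finset.sum_congr rfl (g := fun s => if s = v then (if c = u then 1 else 0) else 0)
        (by intro s _; grind), Finset.sum_ite_eq']
      grind
    rw [Finset.sum_congr rfl h1, Finset.sum_ite_eq']
    grind
  rw [h]
  obtain ⟨j, rfl⟩ := Nat.exists_eq_add_of_le' hk
  rw [← sum_ballot_diagonal, ← Finset.Ico_add_one_right_eq_Icc, Finset.sum_Ico_eq_sum_range]
  refine Finset.sum_congr (by congr 1; omega) fun i hi => ?_
  rw [Finset.mem_range] at hi
  rw [sum_stateCount (by omega) (by omega)]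
  congr 1 <;> omega

theorem containsPat_1123_iff (π : List ℕ) :
    ContainsPat π [1, 1, 2, 3] ↔ ∃ a b c, a < b ∧ b < c ∧ [a, a, b, c].Sublist π := by
  constructor
  · rintro ⟨f, hf, h⟩
    have h' : ∀ i j : Fin 4, [1, 1, 2, 3].get i < [1, 1, 2, 3].get j ↔
      π.get (f i) < π.get (f j) := h
    have h01 := h' 0 1
    have h10 := h' 1 0
    have h12 := h' 1 2
    have h23 := h' 2 3
    simp at h01 h10 h12 h23
    refine ⟨_, _, _, h12, h23, ?_⟩
    rw [List.sublist_iff_exists_fin_orderEmbedding_get_eq]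
    refine ⟨OrderEmbedding.ofStrictMono f hf, ?_⟩
    intro ix
    change Fin 4 at ix
    fin_cases ix <;> simp
    omega
  · rintro ⟨a, b, c, hab, hbc, h⟩
    rw [List.sublist_iff_exists_fin_orderEmbedding_get_eq] at h
    obtain ⟨f, hf⟩ := h
    refine ⟨f, f.strictMono, ?_⟩
    intro i j
    have hi := hf i
    have hj := hf j
    change Fin 4 at i j
    rw [← hi, ← hj]
    fin_cases i <;> fin_cases j <;> simp <;> omega

theorem avoidsPat_reverse_cons_iff (k : ℕ) (l : List ℕ) :
    AvoidsPat (k :: l).reverse [1, 1, 2, 3] ↔ AvoidsPat l.reverse [1, 1, 2, 3] ∧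
      ∀ a b, a < b → [b, a, a].Sublist l → k ≤ b := by
  have h : ∀ m : List ℕ, AvoidsPat m.reverse [1, 1, 2, 3] ↔
      ∀ a b c, a < b → b < c → ¬ [c, b, a, a].Sublist m := by
    intro m
    simp only [AvoidsPat, containsPat_1123_iff, ← List.reverse_sublist (l₂ := m), not_exists,
      not_and, List.reverse_cons, List.reverse_nil, List.nil_append, List.cons_append]
  rw [h, h]
  simp only [List.cons_sublist_cons']
  grind

theorem foldr_max_reverse (l : List ℕ) : l.reverse.foldr max 0 = l.foldr max 0 :=
  (List.reverse_perm l).foldr_eq 0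

theorem isCanonicalSeq_reverse_cons_iff (k : ℕ) (l : List ℕ) :
    IsCanonicalSeq (k :: l).reverse ↔
      IsCanonicalSeq l.reverse ∧ 1 ≤ k ∧ k ≤ l.foldr max 0 + 1 := by
  rw [← foldr_max_reverse l, List.reverse_cons]
  generalize l.reverse = m
  unfold IsCanonicalSeq
  constructor
  · intro h
    constructor
    · intro i hi
      have := h i (by simp; omega)
      simpa [List.getElem_append_left hi, List.take_append_of_le_length hi.le] using this
    · simpa using h m.length (by simp)
  · rintro ⟨h, hk⟩ i hi
    rcases Nat.lt_or_ge i m.length with h' | h'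
    · simpa [List.getElem_append_left h', List.take_append_of_le_length h'.le] using h i h'
    · obtain rfl : i = m.length := by simp at hi; omega
      simpa using hk

/-- The meaning of the state `(c, s)` of a sequence `l` with maximum `M`. -/
structure StateSpec (l : List ℕ) (M c s : ℕ) : Prop where
  mem_iff : ∀ x, x ∈ l ↔ 1 ≤ x ∧ x ≤ M
  one_le : 1 ≤ s
  le : s ≤ c
  le_max : c ≤ M + 1
  le_of_repeated : ∀ a, [a, a].Sublist l → s ≤ a
  repeated : s < c → [s, s].Sublist l
  le_of_ascent : ∀ a y, a < y → [y, a, a].Sublist l → c ≤ y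
  ascent : c = M + 1 ∨ ∃ a < c, [c, a, a].Sublist l
  eq_max : s = c → c = M + 1

theorem StateSpec.cons {l : List ℕ} {M c s k : ℕ} (h : StateSpec l M c s) (hk : 1 ≤ k)
    (hkc : k ≤ c) :
    StateSpec (k :: l) (max k M) (stateStep k (c, s)).1 (stateStep k (c, s)).2 := by
  obtain ⟨h1, h2, h3, h4, h5, h6, h7, h8, h9⟩ := h
  have hsub : ∀ a y, [y, a, a].Sublist l → [a, a].Sublist l := fun a y h =>
    (List.sublist_cons_self y _).trans h
  have hmem : ∀ a, [a, a].Sublist l → a ∈ l := fun a h => h.subset (by simp)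
  obtain ⟨R, hR⟩ : ∃ R : ℕ → Prop, ∀ a, [a, a].Sublist l ↔ R a := ⟨_, fun _ => Iff.rfl⟩
  obtain ⟨P, hP⟩ : ∃ P : ℕ → ℕ → Prop, ∀ y a, [y, a, a].Sublist l ↔ P y a :=
    ⟨_, fun _ _ => Iff.rfl⟩
  simp only [hR, hP, h1] at h5 h6 h7 h8 hsub hmem
  unfold stateStep
  split_ifs with hc hks
  all_goals
    constructor <;> simp only [List.cons_sublist_cons', List.singleton_sublist, List.mem_cons,
      h1, hR, hP]
    all_goals grind

theorem stateSpec_seqState {n : ℕ} {l : List ℕ} (h : l ∈ allowedSeqs n) :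
    StateSpec l (l.foldr max 0) (seqState l).1 (seqState l).2 := by
  induction l generalizing n with
  | nil => constructor <;> simp [seqState]; omega
  | cons k l ih =>
    cases n with
    | zero => simp [allowedSeqs] at h
    | succ n =>
      rw [cons_mem_allowedSeqs] at h
      exact (ih h.1).cons h.2.1 h.2.2

theorem mem_allowedSeqs_iff (n : ℕ) (l : List ℕ) :
    l ∈ allowedSeqs n ↔ l.length = n ∧ IsCanonicalSeq l.reverse ∧
      AvoidsPat l.reverse [1, 1, 2, 3] := by
  induction l generalizing n with
  | nil =>
    have h1 : IsCanonicalSeq [] := fun i h => by simp at h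
    have h2 : AvoidsPat [] [1, 1, 2, 3] := by simp [AvoidsPat, containsPat_1123_iff]
    simp [nil_mem_allowedSeqs, h1, h2, eq_comm]
  | cons k l ih =>
    cases n with
    | zero => simp [allowedSeqs]
    | succ n =>
      rw [cons_mem_allowedSeqs, isCanonicalSeq_reverse_cons_iff, avoidsPat_reverse_cons_iff,
        List.length_cons, Nat.add_right_cancel_iff]
      constructor
      · rintro ⟨hl, hk, hkc⟩
        have hS := stateSpec_seqState hl
        obtain ⟨e, hcan, hav⟩ := (ih n).1 hl
        exact ⟨e, ⟨hcan, hk, hkc.trans hS.le_max⟩, hav,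
          fun a b hab h => hkc.trans (hS.le_of_ascent a b hab h)⟩
      · rintro ⟨e, ⟨hcan, hk, hkM⟩, hav, h⟩
        have hl := (ih n).2 ⟨e, hcan, hav⟩
        refine ⟨hl, hk, ?_⟩
        rcases (stateSpec_seqState hl).ascent with h' | ⟨a, ha, h'⟩
        · omega
        · exact h a _ ha h'

/-- For n ≥ 1 and 1 ≤ k ≤ n, the number t(n,k) of 1123-avoiding
partitions of [n] whose canonical sequence ends with k satisfies
n · t(n,k) = k · C(2n−k−1, n−1). -/
theorem statement17 (n k : ℕ) (hn : 1 ≤ n) (hk : 1 ≤ k) (hkn : k ≤ n) :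
    n * Set.ncard {π : List ℕ | π.length = n ∧ IsCanonicalSeq π ∧
          AvoidsPat π [1, 1, 2, 3] ∧ π.getLast? = some k} =
      k * Nat.choose (2 * n - k - 1) (n - 1) := by
  obtain ⟨n, rfl⟩ := Nat.exists_eq_add_of_le' hn
  have hset : {π : List ℕ | π.length = n + 1 ∧ IsCanonicalSeq π ∧
      AvoidsPat π [1, 1, 2, 3] ∧ π.getLast? = some k} =
      (fun l => (k :: l).reverse) ''
        ((allowedSeqs n).filter fun l => k ≤ (seqState l).1 : Finset (List ℕ)) := by
    ext π
    simp only [Set.mem_ofPred_eq, Set.mem_image, Finset.coe_filter]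
    constructor
    · rintro ⟨h1, h2, h3, h4⟩
      obtain ⟨m, rfl⟩ := List.getLast?_eq_some_iff.1 h4
      have h : k :: m.reverse ∈ allowedSeqs (n + 1) := by
        rw [mem_allowedSeqs_iff]
        simpa using ⟨by simpa using h1, h2, h3⟩
      rw [cons_mem_allowedSeqs] at h
      exact ⟨m.reverse, ⟨h.1, h.2.2⟩, by simp⟩
    · rintro ⟨l, ⟨hl, hkc⟩, rfl⟩
      obtain ⟨h1, h2, h3⟩ := (mem_allowedSeqs_iff (n + 1) (k :: l)).1
        ((cons_mem_allowedSeqs n k l).2 ⟨hl, hk, hkc⟩)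
      exact ⟨by simpa using h1, h2, h3, by simp⟩
  have hinj : Function.Injective fun l : List ℕ => (k :: l).reverse := fun l l' h => by
    simpa using h
  rw [hset, Set.ncard_image_of_injective _ hinj, Set.ncard_coe_finset,
    card_filter_allowedSeqs hk hkn]
  obtain ⟨d, hd⟩ := Nat.exists_eq_add_of_le hkn
  have h := add_mul_ballot d k
  rw [hd, show k + d - k = d by omega, h, show 2 * (k + d) - k - 1 = k + 2 * d - 1 by omega,
    Nat.choose_symm_of_eq_add (show k + 2 * d - 1 = d + (k + d - 1) by omega)]
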